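/- arXiv:1501.05942 — 2 statements merged into one kernel-verified Lean document; each statement's English description precedes it below -/
import Mathlib

section
/- Let Φ ∈ C¹(X,ℝ) be an even functional which maps bounded sets to bounded sets, fix m, and assume condition (A3) holds: there exists an odd locally Lipschitz continuous map B : E_m → Y_m such that (i) B((±D_m^0) ∩ E_m) ⊆ ±D_m^0, (ii) there exists α₁ > 0 with ⟨Φ_m′(u), u − B(u)⟩ ≥ α₁‖u − B(u)‖² for all u ∈ E_m, and (iii) for every a < b and α > 0 there exists β > 0 such that ‖u − B(u)‖ ≥ β whenever Φ_m(u) ∈ [a,b] and ‖Φ_m′(u)‖ ≥ α. Let c ∈ ℝ and ε₀ > 0 be such that ‖Φ_m′(u)‖ ≥ ε₀ for every u ∈ Φ_m^{-1}([c−2ε₀, c+2ε₀]) ∩ V_{μ_m/2}(S_m). Then for some ε ∈ (0, ε₀) there exists a continuous map η : [0,1] × Y_m → Y_m such that: (i) η(t,u) = u whenever t = 0 or u ∉ Φ_m^{-1}([c−2ε, c+2ε]); (ii) η(1, Φ_m^{-1}((−∞, c+ε]) ∩ S_m) ⊆ Φ_m^{-1}((−∞, c−ε]); (iii) for every u, the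 map t ↦ Φ_m(η(t,u)) is non-increasing; (iv) η([0,1] × D_m) ⊆ D_m; (v) η(t,·) is odd for every t ∈ [0,1]. -/
open Metric Set Filter Topology

/-- Convexity inequality for the distance to a convex set. -/
lemma infDist_convex_comb {E : Type*} [NormedAddCommGroup E] [NormedSpace ℝ E] {P : Set E}
    (hP : Convex ℝ P) (hne : P.Nonempty) (x y : E) {a b : ℝ} (ha : 0 ≤ a) (hb : 0 ≤ b)
    (hab : a + b = 1) :
    infDist (a • x + b • y) P ≤ a * infDist x P + b * infDist y P := by
  refine le_of_forall_pos_le_add fun ε hε => ?_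
  obtain ⟨p, hp, hxp⟩ := (infDist_lt_iff hne).1 (lt_add_of_pos_right (infDist x P) hε)
  obtain ⟨q, hq, hyq⟩ := (infDist_lt_iff hne).1 (lt_add_of_pos_right (infDist y P) hε)
  have h1 : infDist (a • x + b • y) P ≤ dist (a • x + b • y) (a • p + b • q) :=
    infDist_le_dist_of_mem (hP hp hq ha hb hab)
  have h2 : dist (a • x + b • y) (a • p + b • q) ≤ a * dist x p + b * dist y q := by
    refine (dist_add_add_le _ _ _ _).trans ?_
    rw [dist_smul₀, dist_smul₀, Real.norm_of_nonneg ha, Real.norm_of_nonneg hb]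
  have h3 : a * dist x p ≤ a * (infDist x P + ε) := mul_le_mul_of_nonneg_left hxp.le ha
  have h4 : b * dist y q ≤ b * (infDist y P + ε) := mul_le_mul_of_nonneg_left hyq.le hb
  have h5 : a * (infDist x P + ε) + b * (infDist y P + ε)
    = a * infDist x P + b * infDist y P + (a + b) * ε := by ring
  rw [hab, one_mul] at h5
  linarith

lemma infDist_neg_neg {E : Type*} [NormedAddCommGroup E] [NormedSpace ℝ E] (P : Set E) (x : E) :
    infDist (-x) (-P) = infDist x P := by
  have h := infDist_image (x := x) (t := P) (Φ := fun y : E => -y) (IsometryEquiv.neg E).isometry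
  rw [Set.image_neg_eq_neg] at h
  exact h

/-- Uniqueness for autonomous ODEs with locally Lipschitz field. -/
lemma ode_unique {E : Type*} [NormedAddCommGroup E] [NormedSpace ℝ E] [ProperSpace E]
    {V : E → E} (hV : LocallyLipschitz V) {f g : ℝ → E}
    (hf : ∀ t ∈ Icc (0 : ℝ) 1, HasDerivWithinAt f (V (f t)) (Icc 0 1) t)
    (hg : ∀ t ∈ Icc (0 : ℝ) 1, HasDerivWithinAt g (V (g t)) (Icc 0 1) t)
    (h0 : f 0 = g 0) : ∀ t ∈ Icc (0 : ℝ) 1, f t = g t := by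
  have cf : ContinuousOn f (Icc 0 1) := fun t ht => (hf t ht).continuousWithinAt
  have cg : ContinuousOn g (Icc 0 1) := fun t ht => (hg t ht).continuousWithinAt
  have hc : IsCompact (f '' Icc 0 1 ∪ g '' Icc 0 1) :=
    (isCompact_Icc.image_of_continuousOn cf).union (isCompact_Icc.image_of_continuousOn cg)
  obtain ⟨K, hK⟩ := (hV.locallyLipschitzOn).exists_lipschitzOnWith_of_compact hc
  have conv : ∀ {h : ℝ → E} {v : E} {t : ℝ}, t ∈ Ico (0 : ℝ) 1 →
      HasDerivWithinAt h v (Icc 0 1) t → HasDerivWithinAt h v (Ici t) t := by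
    intro h v t ht hh
    exact hh.mono_of_mem_nhdsWithin (Icc_mem_nhdsGE_of_mem ht)
  refine ODE_solution_unique_of_mem_Icc_right (v := fun _ => V)
    (s := fun _ => f '' Icc 0 1 ∪ g '' Icc 0 1) (K := K) (fun _ _ => hK) cf ?_ ?_ cg ?_ ?_ h0
  · exact fun t ht => conv ht (hf t (Ico_subset_Icc_self ht))
  · exact fun t ht => Or.inl ⟨t, Ico_subset_Icc_self ht, rfl⟩
  · exact fun t ht => conv ht (hg t (Ico_subset_Icc_self ht))
  · exact fun t ht => Or.inr ⟨t, Ico_subset_Icc_self ht, rfl⟩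

/-- Global flow of a bounded locally Lipschitz field on `[0,1]`. -/
lemma exists_flow {E : Type*} [NormedAddCommGroup E] [NormedSpace ℝ E] [ProperSpace E]
    {V : E → E} (hV : LocallyLipschitz V) {C : ℝ} (hC0 : 0 ≤ C) (hC : ∀ x, ‖V x‖ ≤ C) :
    ∃ η : ℝ × E → E, ContinuousOn η (Icc (0 : ℝ) 1 ×ˢ univ) ∧ (∀ u, η (0, u) = u) ∧
      ∀ u, ∀ t ∈ Icc (0 : ℝ) 1,
        HasDerivWithinAt (fun s => η (s, u)) (V (η (t, u))) (Icc 0 1) t := by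
  have key : ∀ R : ℝ, 0 ≤ R → ∃ α : E × ℝ → E, (∀ x ∈ closedBall (0 : E) R, α ⟨x, 0⟩ = x ∧
      ∀ t ∈ Icc (0 : ℝ) 1, HasDerivWithinAt (fun s => α ⟨x, s⟩) (V (α ⟨x, t⟩)) (Icc 0 1) t) ∧
      ContinuousOn α (closedBall (0 : E) R ×ˢ Icc (0 : ℝ) 1) := by
    intro R hR
    obtain ⟨K, hK⟩ := (hV.locallyLipschitzOn).exists_lipschitzOnWith_of_compact
      (isCompact_closedBall (0 : E) (R + C))
    have hpl : IsPicardLindelof (fun _ : ℝ => V)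
        (⟨0, by simp⟩ : Icc (0 : ℝ) 1) (0 : E) ⟨R + C, by positivity⟩ ⟨R, hR⟩ ⟨C, hC0⟩ K := by
      refine IsPicardLindelof.of_time_independent (fun x _ => hC x) hK ?_
      simp only [sub_zero, sub_self, zero_le_one, sup_of_le_left, mul_one]
      change C ≤ R + C - R
      linarith
    exact hpl.exists_forall_mem_closedBall_eq_hasDerivWithinAt_continuousOn
  have ex : ∀ u : E, ∃ γ : ℝ → E, γ 0 = u ∧
      ∀ t ∈ Icc (0 : ℝ) 1, HasDerivWithinAt γ (V (γ t)) (Icc 0 1) t := by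
    intro u
    obtain ⟨α, hα, -⟩ := key ‖u‖ (norm_nonneg u)
    exact ⟨fun s => α (u, s), hα u (by simp)⟩
  choose γ hγ0 hγ using ex
  refine ⟨fun p => γ p.2 p.1, ?_, hγ0, hγ⟩
  rintro ⟨t, u⟩ ⟨ht, -⟩
  obtain ⟨α, hα, hαc⟩ := key (‖u‖ + 1) (by positivity)
  have hc : ContinuousOn (fun p : ℝ × E => γ p.2 p.1)
      (Icc (0 : ℝ) 1 ×ˢ closedBall (0 : E) (‖u‖ + 1)) := by
    have h1 : ContinuousOn (fun p : ℝ × E => α (p.2, p.1))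
        (Icc (0 : ℝ) 1 ×ˢ closedBall (0 : E) (‖u‖ + 1)) :=
      hαc.comp (by fun_prop) (fun p hp => ⟨hp.2, hp.1⟩)
    refine h1.congr ?_
    rintro ⟨s, v⟩ ⟨hs, hv⟩
    exact ode_unique hV (hγ v) (hα v hv).2 ((hγ0 v).trans (hα v hv).1.symm) s hs
  have hb : closedBall (0 : E) (‖u‖ + 1) ∈ 𝓝 u := by
    refine mem_of_superset (isOpen_ball.mem_nhds ?_) ball_subset_closedBall
    simp
  refine (hc (t, u) ⟨ht, mem_of_mem_nhds hb⟩).mono_of_mem_nhdsWithin ?_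
  rw [nhdsWithin_prod_eq, nhdsWithin_univ]
  exact prod_mem_prod self_mem_nhdsWithin hb

/-- Invariance of a convex open neighbourhood of `P`. -/
lemma infDist_invariant {E : Type*} [NormedAddCommGroup E] [NormedSpace ℝ E] {P : Set E}
    (hP : Convex ℝ P) (hne : P.Nonempty) {μ Λ C : ℝ}
    {γ b : ℝ → E} {l : ℝ → ℝ}
    (hγ : ∀ t ∈ Icc (0 : ℝ) 1, HasDerivWithinAt γ (-(l t • (γ t - b t))) (Icc 0 1) t)
    (hC : ∀ t, ‖l t • (γ t - b t)‖ ≤ C)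
    (hl0 : ∀ t, 0 ≤ l t) (hl : ∀ t, l t ≤ Λ)
    (hb : ∀ t, l t ≠ 0 → infDist (γ t) P < μ → infDist (b t) P < μ)
    (h0 : infDist (γ 0) P < μ) : ∀ t ∈ Icc (0 : ℝ) 1, infDist (γ t) P < μ := by
  classical
  have cγ : ContinuousOn γ (Icc 0 1) := fun t ht => (hγ t ht).continuousWithinAt
  set δ := μ - infDist (γ 0) P with hδ
  have hδ0 : 0 < δ := by linarith
  set f' : ℝ → ℝ := fun x => if infDist (γ x) P < μ then l x * (μ - infDist (γ x) P) else C with hf'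
  have main := image_le_of_liminf_slope_right_lt_deriv_boundary
    (f := fun t => infDist (γ t) P) (f' := f') (a := 0) (b := 1)
    (B := fun t => μ - δ * Real.exp (-(Λ + 1) * t))
    (B' := fun t => δ * ((Λ + 1) * Real.exp (-(Λ + 1) * t)))
    ((continuous_infDist_pt P).comp_continuousOn cγ) ?_ ?_ ?_ ?_
  · intro t ht
    have : infDist (γ t) P ≤ μ - δ * Real.exp (-(Λ + 1) * t) := main ht
    have h2 : 0 < δ * Real.exp (-(Λ + 1) * t) := by positivity
    linarith
  · intro x hx r hr
    apply Filter.Eventually.frequently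
    have hd : HasDerivWithinAt γ (-(l x • (γ x - b x))) (Ioi x) x :=
      ((hγ x (Ico_subset_Icc_self hx)).mono_of_mem_nhdsWithin
        (Icc_mem_nhdsGT_of_mem hx))
    set v := -(l x • (γ x - b x)) with hv
    have hlo := (hasDerivWithinAt_iff_isLittleO.1 hd).def (c := (r - f' x) / 2) (by linarith)
    have hsmall : ∀ᶠ z in 𝓝[>] x, z < x + 1 / (l x + 1) := by
      have : Iio (x + 1 / (l x + 1)) ∈ 𝓝 x := by
        apply Iio_mem_nhds
        have := hl0 x
        have : 0 < 1 / (l x + 1) := by positivity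
        linarith
      exact mem_nhdsWithin_of_mem_nhds this
    filter_upwards [hlo, hsmall, self_mem_nhdsWithin] with z hz hz2 hz3
    have hh : 0 < z - x := sub_pos.2 hz3
    have hlx := hl0 x
    have hhl : (z - x) * l x ≤ 1 := by
      have h1 : z - x ≤ 1 / (l x + 1) := by linarith
      have h2 : (z - x) * (l x + 1) ≤ 1 := by rwa [le_div_iff₀ (by positivity)] at h1
      nlinarith
    rw [slope_def_field, div_lt_iff₀ hh]
    have hz' : ‖γ z - γ x - (z - x) • v‖ ≤ (r - f' x) / 2 * (z - x) := by
      rwa [Real.norm_of_nonneg hh.le] at hz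
    have hA : infDist (γ z) P ≤ infDist (γ x + (z - x) • v) P + (r - f' x) / 2 * (z - x) := by
      refine (infDist_le_infDist_add_dist (y := γ x + (z - x) • v)).trans ?_
      gcongr
      rw [dist_eq_norm, ← sub_sub]
      exact hz'
    have hB : infDist (γ x + (z - x) • v) P ≤ infDist (γ x) P + (z - x) * f' x := by
      by_cases hm : infDist (γ x) P < μ
      · have e1 : f' x = l x * (μ - infDist (γ x) P) := by simp [hf', hm]
        have e2 : γ x + (z - x) • v = (1 - (z - x) * l x) • γ x + ((z - x) * l x) • b x := by
          rw [hv]; module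
        rw [e1, e2]
        have := infDist_convex_comb hP hne (γ x) (b x) (a := 1 - (z - x) * l x)
          (b := (z - x) * l x) (by linarith) (by positivity) (by ring)
        by_cases hlz : l x = 0
        · simp [hlz]
        · have h5 := mul_le_mul_of_nonneg_left (hb x hlz hm).le
            (show 0 ≤ (z - x) * l x by positivity)
          nlinarith
      · have e1 : f' x = C := by simp [hf', hm]
        rw [e1]
        refine infDist_le_infDist_add_dist (y := γ x) |>.trans ?_
        gcongr
        rw [dist_eq_norm, add_sub_cancel_left, norm_smul, Real.norm_of_nonneg hh.le, hv, norm_neg]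
        exact mul_le_mul_of_nonneg_left (hC x) hh.le
    nlinarith
  · simp [hδ]
  · intro x
    have h1 : HasDerivAt (fun t : ℝ => -(Λ + 1) * t) (-(Λ + 1)) x := by
      simpa using (hasDerivAt_id x).const_mul (-(Λ + 1))
    have := (h1.exp.const_mul δ).const_sub μ
    exact this.congr_deriv (by ring)
  · intro x hx hfx
    replace hfx : infDist (γ x) P = μ - δ * Real.exp (-(Λ + 1) * x) := hfx
    have h2 : 0 < δ * Real.exp (-(Λ + 1) * x) := by positivity
    have hm : infDist (γ x) P < μ := by linarith
    have e1 : f' x = l x * (μ - infDist (γ x) P) := by simp [hf', hm]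
    rw [e1, hfx]
    have := hl x
    nlinarith

/-- pointwise local Lipschitz property -/
def LipAt {E F : Type*} [PseudoEMetricSpace E] [PseudoEMetricSpace F] (f : E → F) (x : E) : Prop :=
  ∃ K, ∃ t ∈ 𝓝 x, LipschitzOnWith K f t

lemma LipAt.continuousAt {E F : Type*} [PseudoEMetricSpace E] [PseudoEMetricSpace F]
    {f : E → F} {x : E} (h : LipAt f x) : ContinuousAt f x := by
  obtain ⟨K, t, ht, h⟩ := h
  exact h.continuousOn.continuousAt ht

lemma LipAt.comp {E F G : Type*} [PseudoEMetricSpace E] [PseudoEMetricSpace F]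
    [PseudoEMetricSpace G] {g : F → G} {f : E → F} {x : E} (hg : LipAt g (f x)) (hf : LipAt f x) :
    LipAt (fun y => g (f y)) x := by
  have hc := hf.continuousAt
  obtain ⟨K, t, ht, h⟩ := hf
  obtain ⟨K', t', ht', h'⟩ := hg
  exact ⟨K' * K, t ∩ f ⁻¹' t', inter_mem ht (hc ht'),
    h'.comp (h.mono inter_subset_left) (fun y hy => hy.2)⟩

lemma LipAt.prodMk {E F G : Type*} [PseudoEMetricSpace E] [PseudoEMetricSpace F]
    [PseudoEMetricSpace G] {g : E → G} {f : E → F} {x : E} (hf : LipAt f x) (hg : LipAt g x) :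
    LipAt (fun y => (f y, g y)) x := by
  obtain ⟨K, t, ht, h⟩ := hf
  obtain ⟨K', t', ht', h'⟩ := hg
  exact ⟨max K K', t ∩ t', inter_mem ht ht',
    (h.mono inter_subset_left).prodMk (h'.mono inter_subset_right)⟩

lemma LipAt.smul {E F : Type*} [PseudoEMetricSpace E] [NormedAddCommGroup F] [NormedSpace ℝ F]
    {l : E → ℝ} {f : E → F} {x : E} (hl : LipAt l x) (hf : LipAt f x) :
    LipAt (fun y => l y • f y) x := by
  have h : LipAt (fun p : ℝ × F => p.1 • p.2) (l x, f x) :=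
    (contDiff_smul (𝕜 := ℝ) (n := 1)).contDiffAt.exists_lipschitzOnWith
  exact h.comp (f := fun y => (l y, f y)) (hl.prodMk hf)

lemma LipAt.sub {E F : Type*} [PseudoEMetricSpace E] [NormedAddCommGroup F] [NormedSpace ℝ F]
    {l : E → F} {f : E → F} {x : E} (hl : LipAt l x) (hf : LipAt f x) :
    LipAt (fun y => l y - f y) x := by
  have h : LipAt (fun p : F × F => p.1 - p.2) (l x, f x) :=
    (contDiff_fst.sub contDiff_snd : ContDiff ℝ 1 (fun p : F × F => p.1 - p.2)).contDiffAt.exists_lipschitzOnWith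
  exact h.comp (f := fun y => (l y, f y)) (hl.prodMk hf)

lemma LipAt.congr {E F : Type*} [PseudoEMetricSpace E] [PseudoEMetricSpace F]
    {f g : E → F} {x : E} (h : LipAt f x) (hfg : ∀ᶠ y in 𝓝 x, g y = f y) : LipAt g x := by
  obtain ⟨K, t, ht, h⟩ := h
  refine ⟨K, t ∩ {y | g y = f y}, inter_mem ht hfg, ?_⟩
  intro y hy z hz
  rw [hy.2, hz.2]
  exact h hy.1 hz.1

lemma LipschitzWith.lipAt {E F : Type*} [PseudoEMetricSpace E] [PseudoEMetricSpace F]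
    {f : E → F} {K : NNReal} (h : LipschitzWith K f) (x : E) : LipAt f x :=
  ⟨K, univ, univ_mem, h.lipschitzOnWith⟩

/-- The deformation lemma in a proper normed space. -/
lemma deformation_core {E : Type*} [NormedAddCommGroup E] [NormedSpace ℝ E] [ProperSpace E]
    (φ : E → ℝ) (hφ : ContDiff ℝ 1 φ) (heven : ∀ u, φ (-u) = φ u)
    (μ : ℝ) (hμ : 0 < μ) (Em : Set E) (hEm : Em = {u | fderiv ℝ φ u = 0}ᶜ)
    (P : Set E) (hPconv : Convex ℝ P) (hPne : P.Nonempty)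
    (S : Set E) (hS : S = ({u | infDist u P < μ} ∪ {u | infDist u (-P) < μ})ᶜ)
    (B : E → E) (hBodd : ∀ u ∈ Em, B (-u) = -B u) (hBlip : LocallyLipschitzOn Em B)
    (hB1 : ∀ u ∈ Em, infDist u P < μ → infDist (B u) P < μ)
    (hB2 : ∀ u ∈ Em, infDist u (-P) < μ → infDist (B u) (-P) < μ)
    (α₁ : ℝ) (hα₁ : 0 < α₁)
    (hBii : ∀ u ∈ Em, α₁ * ‖u - B u‖ ^ 2 ≤ fderiv ℝ φ u (u - B u))
    (c ε₀ : ℝ) (hε₀ : 0 < ε₀) (β : ℝ) (hβ : 0 < β)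
    (hN : ∀ u, φ u ∈ Icc (c - 2 * ε₀) (c + 2 * ε₀) → infDist u S ≤ μ / 2 →
      u ∈ Em ∧ β ≤ ‖u - B u‖) :
    ∃ ε : ℝ, 0 < ε ∧ ε < ε₀ ∧ ∃ η : ℝ × E → E,
      ContinuousOn η (Icc (0 : ℝ) 1 ×ˢ univ) ∧
      (∀ u : E, η (0, u) = u) ∧
      (∀ t ∈ Icc (0 : ℝ) 1, ∀ u : E,
        φ u ∉ Icc (c - 2 * ε) (c + 2 * ε) → η (t, u) = u) ∧
      (∀ u ∈ S, φ u ≤ c + ε → φ (η (1, u)) ≤ c - ε) ∧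
      (∀ u : E, AntitoneOn (fun t => φ (η (t, u))) (Icc (0 : ℝ) 1)) ∧
      (∀ t ∈ Icc (0 : ℝ) 1, ∀ u ∈ {u | infDist u P < μ} ∪ {u | infDist u (-P) < μ},
        η (t, u) ∈ {u | infDist u P < μ} ∪ {u | infDist u (-P) < μ}) ∧
      (∀ t ∈ Icc (0 : ℝ) 1, ∀ u : E, η (t, -u) = -η (t, u)) := by
  have hdiff : Differentiable ℝ φ := hφ.differentiable one_ne_zero
  have hEopen : IsOpen Em := by
    rw [hEm]
    exact (isClosed_eq (hφ.continuous_fderiv one_ne_zero) continuous_const).isOpen_compl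
  have hSsymm : ∀ u, infDist (-u) S = infDist u S := by
    have hSS : -S = S := by
      ext u
      have h1 := infDist_neg_neg P u
      have h2 := infDist_neg_neg (-P) u
      rw [neg_neg] at h2
      rw [Set.mem_neg, hS]
      simp only [mem_compl_iff, mem_union, mem_ofPred_eq, h1, h2]
      tauto
    intro u
    have := infDist_neg_neg S u
    rwa [hSS] at this
  set ε : ℝ := min (ε₀ / 2) (μ * α₁ * β / 8) with hε
  have hε1 : ε ≤ ε₀ / 2 := min_le_left _ _
  have hε2 : ε ≤ μ * α₁ * β / 8 := min_le_right _ _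
  have hεpos : 0 < ε := by
    rw [hε]
    exact lt_min (by positivity) (by positivity)
  set T : ℝ := μ / 4 with hT
  have hTpos : 0 < T := by positivity
  -- cutoffs
  set χ : E → ℝ := fun u => max 0 (min 1 (2 - ε⁻¹ * |φ u - c|)) *
    max 0 (min 1 (2 - (4 / μ) * infDist u S)) with hχ
  have hχ0 : ∀ u, 0 ≤ χ u := fun u => mul_nonneg (le_max_left _ _) (le_max_left _ _)
  have hclamp : ∀ r : ℝ, max 0 (min 1 r) ≤ 1 := fun r => max_le zero_le_one (min_le_left _ _)
  have hχ1 : ∀ u, χ u ≤ 1 := fun u => mul_le_one₀ (hclamp _) (le_max_left _ _) (hclamp _)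
  have hχeven : ∀ u, χ (-u) = χ u := fun u => by simp only [hχ, heven, hSsymm]
  have hχa : ∀ u, χ u ≠ 0 → φ u ∈ Icc (c - 2 * ε) (c + 2 * ε) ∧ infDist u S ≤ μ / 2 := by
    intro u hu
    have h1 := left_ne_zero_of_mul hu
    have h2 := right_ne_zero_of_mul hu
    constructor
    · by_contra hcon
      apply h1
      have : 2 * ε ≤ |φ u - c| := by
        by_contra hlt
        push Not at hlt
        rw [abs_lt] at hlt
        exact hcon ⟨by linarith, by linarith⟩
      have h3 : 2 ≤ ε⁻¹ * |φ u - c| := by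
        rw [inv_mul_eq_div, le_div_iff₀ hεpos]; exact this
      exact max_eq_left ((min_le_right _ _).trans (by linarith))
    · by_contra hcon
      push Not at hcon
      apply h2
      have h3 : 2 ≤ 4 / μ * infDist u S := by
        rw [div_mul_eq_mul_div, le_div_iff₀ hμ]; linarith
      exact max_eq_left ((min_le_right _ _).trans (by linarith))
  have hχone : ∀ u, |φ u - c| ≤ ε → infDist u S ≤ μ / 4 → χ u = 1 := by
    intro u h1 h2
    have h3 : ε⁻¹ * |φ u - c| ≤ 1 := by
      rw [inv_mul_eq_div, div_le_iff₀ hεpos]; linarith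
    have h4 : 4 / μ * infDist u S ≤ 1 := by
      rw [div_mul_eq_mul_div, div_le_iff₀ hμ]; linarith
    simp only [hχ]
    rw [min_eq_left (by linarith), min_eq_left (by linarith)]
    simp
  have hχN : ∀ u, χ u ≠ 0 → u ∈ Em ∧ β ≤ ‖u - B u‖ := by
    intro u hu
    obtain ⟨⟨h1, h2⟩, h3⟩ := hχa u hu
    exact hN u ⟨by linarith, by linarith⟩ h3
  have hclampLip : LipschitzWith 1 (fun r : ℝ => max 0 (min 1 r)) :=
    (LipschitzWith.id.const_min 1).const_max 0
  have hχLip : ∀ u, LipAt χ u := by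
    intro u
    have hφL : LipAt φ u := hφ.contDiffAt.exists_lipschitzOnWith
    have hab : LipAt (fun r : ℝ => |r|) (φ u - c) := lipschitzWith_one_norm.lipAt (φ u - c)
    have hcst : ∀ r : ℝ, LipAt (fun _ : E => r) u := fun r => (LipschitzWith.const r).lipAt u
    have h1 : LipAt (fun u => 2 - ε⁻¹ • |φ u - c|) u :=
      (hcst 2).sub ((hcst ε⁻¹).smul (hab.comp (f := fun u => φ u - c) (hφL.sub (hcst c))))
    have h2 : LipAt (fun u => 2 - (4 / μ) • infDist u S) u :=
      (hcst 2).sub ((hcst (4 / μ)).smul ((lipschitz_infDist_pt S).lipAt u))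
    exact ((hclampLip.lipAt _).comp h1).smul ((hclampLip.lipAt _).comp h2)
  -- the coefficient
  set l : E → ℝ := fun u => χ u * (T / max ‖u - B u‖ β) with hl
  have hmaxpos : ∀ u, 0 < max ‖u - B u‖ β := fun u => lt_max_of_lt_right hβ
  have hl0 : ∀ u, 0 ≤ l u := fun u =>
    mul_nonneg (hχ0 u) (div_nonneg hTpos.le (hmaxpos u).le)
  have hlΛ : ∀ u, l u ≤ T / β := by
    intro u
    have h1 : T / max ‖u - B u‖ β ≤ T / β := by
      gcongr
      exact le_max_right _ _
    have h2 := mul_le_mul (hχ1 u) h1 (div_nonneg hTpos.le (hmaxpos u).le) zero_le_one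
    rwa [one_mul] at h2
  have hlχ : ∀ u, l u ≠ 0 → χ u ≠ 0 := fun u hu => left_ne_zero_of_mul hu
  have hlC : ∀ u, ‖l u • (u - B u)‖ ≤ T := by
    intro u
    rw [norm_smul, Real.norm_of_nonneg (hl0 u)]
    have h1 : T / max ‖u - B u‖ β * ‖u - B u‖ ≤ T := by
      rw [div_mul_eq_mul_div, div_le_iff₀ (hmaxpos u)]
      exact mul_le_mul_of_nonneg_left (le_max_left _ _) hTpos.le
    have h2 : 0 ≤ T / max ‖u - B u‖ β * ‖u - B u‖ :=
      mul_nonneg (div_nonneg hTpos.le (hmaxpos u).le) (norm_nonneg _)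
    have h3 := mul_le_mul (hχ1 u) h1 h2 zero_le_one
    simp only [hl]
    rw [mul_assoc]
    linarith
  set V : E → E := fun u => -(l u • (u - B u)) with hV
  have hVC : ∀ u, ‖V u‖ ≤ T := fun u => by
    simp only [hV, norm_neg]
    exact hlC u
  have hVzero : ∀ u, χ u = 0 → V u = 0 := fun u hu => by simp [hV, hl, hu]
  have hVodd : ∀ u, V (-u) = -V u := by
    intro u
    by_cases hu : χ u = 0
    · rw [hVzero u hu, hVzero (-u) (by rw [hχeven, hu]), neg_zero]
    · have hb := hBodd u (hχN u hu).1
      have e : -u - B (-u) = -(u - B u) := by rw [hb]; abel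
      simp only [hV, hl, e, norm_neg, hχeven, smul_neg]
  have hVlip : LocallyLipschitz V := by
    intro u
    change LipAt V u
    by_cases hu : u ∈ Em
    · have hBL : LipAt B u := by
        obtain ⟨K, t, ht, h⟩ := hBlip hu
        rw [hEopen.nhdsWithin_eq hu] at ht
        exact ⟨K, t, ht, h⟩
      have hF : LipAt (fun u => u - B u) u := (LipschitzWith.id.lipAt u).sub hBL
      have hG : LipAt (fun u => max ‖u - B u‖ β) u := by
        have : LipschitzWith 1 (fun x : E => max ‖x‖ β) := lipschitzWith_one_norm.max_const β
        exact (this.lipAt (u - B u)).comp (f := fun u => u - B u) hF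
      have hI : LipAt (fun r : ℝ => T / r) (max ‖u - B u‖ β) :=
        (contDiffAt_const.div contDiffAt_id (hmaxpos u).ne' :
          ContDiffAt ℝ 1 (fun r : ℝ => T / r) (max ‖u - B u‖ β)).exists_lipschitzOnWith
      have hL : LipAt l u := (hχLip u).smul (hI.comp (f := fun u => max ‖u - B u‖ β) hG)
      have h0 : LipAt (fun _ : E => (0 : E)) u := (LipschitzWith.const 0).lipAt u
      refine (h0.sub (hL.smul hF)).congr (Eventually.of_forall fun y => ?_)
      simp [hV]
    · have h0 : LipAt (fun _ : E => (0 : E)) u := (LipschitzWith.const 0).lipAt u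
      refine h0.congr ?_
      have hcl : IsClosed {u : E | φ u ∈ Icc (c - 2 * ε₀) (c + 2 * ε₀) ∧ infDist u S ≤ μ / 2} :=
        (isClosed_Icc.preimage hφ.continuous).inter
          (isClosed_le (continuous_infDist_pt S) continuous_const)
      have hmem : {u : E | φ u ∈ Icc (c - 2 * ε₀) (c + 2 * ε₀) ∧ infDist u S ≤ μ / 2}ᶜ ∈ 𝓝 u :=
        hcl.isOpen_compl.mem_nhds fun h => hu (hN u h.1 h.2).1
      filter_upwards [hmem] with y hy
      apply hVzero
      by_contra hne
      obtain ⟨⟨h1, h2⟩, h3⟩ := hχa y hne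
      exact hy ⟨⟨by linarith, by linarith⟩, h3⟩
  obtain ⟨η, hηc, hη0, hη⟩ := exists_flow hVlip hTpos.le hVC
  -- derivative of `φ` along the field
  have hφV : ∀ u, fderiv ℝ φ u (V u) ≤ -(l u * (α₁ * ‖u - B u‖ ^ 2)) := by
    intro u
    simp only [hV, map_neg, map_smul, smul_eq_mul]
    by_cases hu : l u = 0
    · simp [hu]
    · have := mul_le_mul_of_nonneg_left (hBii u (hχN u (hlχ u hu)).1) (hl0 u)
      linarith
  have hφη : ∀ u, ∀ t ∈ Icc (0 : ℝ) 1, HasDerivWithinAt (fun s => φ (η (s, u)))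
      (fderiv ℝ φ (η (t, u)) (V (η (t, u)))) (Icc 0 1) t := fun u t ht =>
    (hdiff (η (t, u))).hasFDerivAt.comp_hasDerivWithinAt t (hη u t ht)
  have hcont : ∀ u, ContinuousOn (fun s => φ (η (s, u))) (Icc 0 1) := fun u t ht =>
    (hφη u t ht).continuousWithinAt
  have hanti : ∀ u : E, AntitoneOn (fun t => φ (η (t, u))) (Icc (0 : ℝ) 1) := by
    intro u
    refine antitoneOn_of_hasDerivWithinAt_nonpos (convex_Icc 0 1) (hcont u)
      (f' := fun t => fderiv ℝ φ (η (t, u)) (V (η (t, u)))) ?_ ?_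
    · intro t ht
      exact (hφη u t (interior_subset ht)).mono interior_subset
    · intro t _
      refine (hφV _).trans ?_
      have := hl0 (η (t, u))
      have : 0 ≤ l (η (t, u)) * (α₁ * ‖η (t, u) - B (η (t, u))‖ ^ 2) := by positivity
      linarith
  refine ⟨ε, hεpos, by linarith, η, hηc, hη0, ?_, ?_, hanti, ?_, ?_⟩
  · intro t ht u hu
    have hχu : χ u = 0 := by
      by_contra h
      exact hu (hχa u h).1
    refine ode_unique hVlip (g := fun _ => u) (hη u) (fun s _ => ?_) (hη0 u) t ht
    rw [hVzero u hχu]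
    exact hasDerivWithinAt_const _ _ _
  · intro u hu hφu
    by_contra hcon
    push Not at hcon
    have hrange : ∀ t ∈ Icc (0 : ℝ) 1, |φ (η (t, u)) - c| ≤ ε := by
      intro t ht
      have h1 := hanti u (left_mem_Icc.2 zero_le_one) ht ht.1
      have h2 := hanti u ht (right_mem_Icc.2 zero_le_one) ht.2
      simp only [hη0] at h1 h2
      rw [abs_le]
      constructor <;> linarith
    have hdist : ∀ t ∈ Icc (0 : ℝ) 1, infDist (η (t, u)) S ≤ μ / 4 := by
      intro t ht
      have h1 := (convex_Icc (0 : ℝ) 1).norm_image_sub_le_of_norm_hasDerivWithin_le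
        (C := T) (hη u) (fun x _ => hVC _) (left_mem_Icc.2 zero_le_one) ht
      simp only [hη0, sub_zero] at h1
      rw [Real.norm_of_nonneg ht.1] at h1
      have h2 := infDist_le_dist_of_mem (x := η (t, u)) hu
      rw [dist_eq_norm] at h2
      nlinarith [ht.2]
    have hder : ∀ t ∈ Icc (0 : ℝ) 1,
        fderiv ℝ φ (η (t, u)) (V (η (t, u))) ≤ -(T * α₁ * β) := by
      intro t ht
      set w := η (t, u) with hw
      have hone : χ w = 1 := hχone w (hrange t ht) (hdist t ht)
      have hb := (hχN w (by rw [hone]; exact one_ne_zero)).2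
      refine (hφV w).trans (neg_le_neg ?_)
      have hpos : 0 < ‖w - B w‖ := hβ.trans_le hb
      have : l w = T / ‖w - B w‖ := by simp only [hl, hone, one_mul, max_eq_left hb]
      rw [this]
      have e : T / ‖w - B w‖ * (α₁ * ‖w - B w‖ ^ 2) = T * α₁ * ‖w - B w‖ := by
        field_simp
      rw [e]
      gcongr
    have hfin : φ (η (1, u)) ≤ φ u + -(T * α₁ * β) * 1 := by
      have := image_le_of_deriv_right_le_deriv_boundary (f := fun s => φ (η (s, u)))
        (f' := fun t => fderiv ℝ φ (η (t, u)) (V (η (t, u)))) (a := 0) (b := 1) (hcont u)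
        (fun x hx => (hφη u x (Ico_subset_Icc_self hx)).mono_of_mem_nhdsWithin
          (Icc_mem_nhdsGE_of_mem hx))
        (B := fun t => φ u + -(T * α₁ * β) * t) (B' := fun _ => -(T * α₁ * β))
        (by simp [hη0]) (by fun_prop)
        (fun x _ => by
          have h := ((hasDerivAt_id x).const_mul (-(T * α₁ * β))).const_add (φ u)
          rw [mul_one] at h
          exact h.hasDerivWithinAt)
        (fun x hx => hder x (Ico_subset_Icc_self hx))
      exact this (right_mem_Icc.2 zero_le_one)
    have : 2 * ε ≤ T * α₁ * β := by rw [hT]; linarith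
    linarith
  · intro t ht u hu
    have hinv : ∀ Q : Set E, Convex ℝ Q → Q.Nonempty →
        (∀ u ∈ Em, infDist u Q < μ → infDist (B u) Q < μ) → infDist u Q < μ →
        infDist (η (t, u)) Q < μ := by
      intro Q hQ hQne hBQ huQ
      exact infDist_invariant hQ hQne (γ := fun s => η (s, u)) (b := fun s => B (η (s, u)))
        (l := fun s => l (η (s, u))) (Λ := T / β) (C := T) (hη u) (fun s => hlC _)
        (fun s => hl0 _) (fun s => hlΛ _)
        (fun s hs h => hBQ _ (hχN _ (hlχ _ hs)).1 h) (by simpa [hη0] using huQ) t ht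
    rcases hu with hu | hu
    · exact Or.inl (hinv P hPconv hPne hB1 hu)
    · exact Or.inr (hinv (-P) hPconv.neg hPne.neg hB2 hu)
  · intro t ht u
    refine ode_unique hVlip (g := fun s => -η (s, u)) (hη (-u)) (fun s hs => ?_)
      (by simp [hη0]) t ht
    rw [hVodd]
    exact (hη u s hs).neg

/-- The deformation lemma (Lemma 2.2 of the paper). -/
theorem deformation_lemma
    {X : Type*} [NormedAddCommGroup X] [InnerProductSpace ℝ X] [CompleteSpace X]
    -- the finite-dimensional pieces whose (closed) direct sum is X
    (Xs : ℕ → Submodule ℝ X)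
    (hXfin : ∀ j, FiniteDimensional ℝ (Xs j))
    (hXindep : iSupIndep Xs)
    (hXdense : (⨆ j, Xs j).topologicalClosure = ⊤)
    -- the functional Φ : even, C¹, mapping bounded sets to bounded sets
    (Φ : X → ℝ) (hΦC1 : ContDiff ℝ 1 Φ) (hΦeven : ∀ u : X, Φ (-u) = Φ u)
    (hΦbdd : ∀ s : Set X, Bornology.IsBounded s → Bornology.IsBounded (Φ '' s))
    -- the fixed index m and the subspace Y_m
    (m : ℕ) (μm : ℝ) (hμm : 0 < μm)
    (Y : ℕ → Submodule ℝ X) (hY : ∀ j, Y j = ⨆ i ∈ Finset.range (j + 1), Xs i)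
    -- the restriction Φ_m of Φ to Y_m, its critical set K_m and E_m = Y_m \ K_m
    (Φm : ↥(Y m) → ℝ) (hΦm : ∀ u : ↥(Y m), Φm u = Φ (u : X))
    (Km Em : Set ↥(Y m))
    (hKm : Km = {u : ↥(Y m) | fderiv ℝ Φm u = 0})
    (hEm : Em = Kmᶜ)
    -- the closed convex cone P_m and the sets ±D_m⁰, D_m, S_m
    (P : Set ↥(Y m)) (hPclosed : IsClosed P) (hPconv : Convex ℝ P)
    (hPcone : ∀ c : ℝ, 0 ≤ c → ∀ u ∈ P, c • u ∈ P)
    (D0 negD0 Dm Sm : Set ↥(Y m))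
    (hD0 : D0 = {u : ↥(Y m) | infDist u P < μm})
    (hnegD0 : negD0 = {u : ↥(Y m) | infDist u (-P) < μm})
    (hDm : Dm = D0 ∪ negD0) (hSm : Sm = Dmᶜ)
    -- (A3) : the odd locally Lipschitz vector field B
    (B : ↥(Y m) → ↥(Y m))
    (hBodd : ∀ u ∈ Em, B (-u) = -B u)
    (hBlip : LocallyLipschitzOn Em B)
    (hBi : (∀ u ∈ D0 ∩ Em, B u ∈ D0) ∧ (∀ u ∈ negD0 ∩ Em, B u ∈ negD0))
    (hBii : ∃ α₁ : ℝ, 0 < α₁ ∧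
      ∀ u ∈ Em, α₁ * ‖u - B u‖ ^ 2 ≤ fderiv ℝ Φm u (u - B u))
    (hBiii : ∀ a b : ℝ, a < b → ∀ α : ℝ, 0 < α → ∃ β : ℝ, 0 < β ∧
      ∀ u : ↥(Y m), Φm u ∈ Icc a b → α ≤ ‖fderiv ℝ Φm u‖ → β ≤ ‖u - B u‖)
    -- the level c and ε₀ with no "almost critical" points near S_m at levels near c
    (c ε₀ : ℝ) (hε₀ : 0 < ε₀)
    (hcrit : ∀ u : ↥(Y m), Φm u ∈ Icc (c - 2 * ε₀) (c + 2 * ε₀) →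
      infDist u Sm ≤ μm / 2 → ε₀ ≤ ‖fderiv ℝ Φm u‖) :
    -- conclusion: existence of the deformation η
    ∃ ε : ℝ, 0 < ε ∧ ε < ε₀ ∧ ∃ η : ℝ × ↥(Y m) → ↥(Y m),
      ContinuousOn η (Icc (0 : ℝ) 1 ×ˢ univ) ∧
      -- (i)
      (∀ u : ↥(Y m), η (0, u) = u) ∧
      (∀ t ∈ Icc (0 : ℝ) 1, ∀ u : ↥(Y m),
        Φm u ∉ Icc (c - 2 * ε) (c + 2 * ε) → η (t, u) = u) ∧
      -- (ii)
      (∀ u ∈ Sm, Φm u ≤ c + ε → Φm (η (1, u)) ≤ c - ε) ∧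
      -- (iii)
      (∀ u : ↥(Y m), AntitoneOn (fun t => Φm (η (t, u))) (Icc (0 : ℝ) 1)) ∧
      -- (iv)
      (∀ t ∈ Icc (0 : ℝ) 1, ∀ u ∈ Dm, η (t, u) ∈ Dm) ∧
      -- (v)
      (∀ t ∈ Icc (0 : ℝ) 1, ∀ u : ↥(Y m), η (t, -u) = -η (t, u)) := by
  have hfin : FiniteDimensional ℝ ↥(Y m) := by
    rw [hY m]
    rw [← Finset.sup_eq_iSup]
    exact Submodule.finiteDimensional_finset_sup (Finset.range (m + 1)) Xs
  have hproper : ProperSpace ↥(Y m) := FiniteDimensional.proper ℝ _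
  have hΦmeq : Φm = fun u : ↥(Y m) => Φ ((Y m).subtypeL u) := funext hΦm
  have hC1 : ContDiff ℝ 1 Φm := by
    rw [hΦmeq]
    exact hΦC1.comp (Y m).subtypeL.contDiff
  have heven : ∀ u, Φm (-u) = Φm u := fun u => by
    rw [hΦm, hΦm, Submodule.coe_neg, hΦeven]
  rcases Sm.eq_empty_or_nonempty with hSe | hSne
  · refine ⟨ε₀ / 2, by positivity, by linarith, fun p => p.2, continuous_snd.continuousOn,
      fun _ => rfl, fun _ _ _ _ => rfl, ?_, ?_, fun _ _ u hu => hu, fun _ _ _ => rfl⟩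
    · intro u hu
      rw [hSe] at hu
      exact absurd hu (notMem_empty u)
    · intro u x _ y _ _
      exact le_rfl
  have hPne : P.Nonempty := by
    by_contra hcon
    rw [not_nonempty_iff_eq_empty] at hcon
    obtain ⟨u, hu⟩ := hSne
    rw [hSm, hDm, hD0, hcon] at hu
    apply hu
    left
    simpa using hμm
  obtain ⟨α₁, hα₁, hBii⟩ := hBii
  obtain ⟨β, hβ, hBβ⟩ := hBiii (c - 2 * ε₀) (c + 2 * ε₀) (by linarith) ε₀ hε₀
  subst hD0 hnegD0 hDm
  refine deformation_core Φm hC1 heven μm hμm Em (by rw [hEm, hKm]) P hPconv hPne Sm hSm B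
    hBodd hBlip (fun u hu h => hBi.1 u ⟨h, hu⟩) (fun u hu h => hBi.2 u ⟨h, hu⟩) α₁ hα₁ hBii
    c ε₀ hε₀ β hβ ?_
  intro u hu hd
  have h := hcrit u hu hd
  refine ⟨?_, hBβ u hu h⟩
  rw [hEm, hKm]
  intro h0
  have h1 : fderiv ℝ Φm u = 0 := h0
  have h2 : ‖fderiv ℝ Φm u‖ = 0 := by
    rw [h1]
    exact ContinuousLinearMap.opNorm_zero
  linarith
end

section
/- Let M be a closed convex subset of a real Banach space E and let H : M → E be a locally Lipschitz continuous map such that lim_{β→0⁺} dist(u + βH(u), M)/β = 0 for every u ∈ M. Then for every u₀ ∈ M there exists δ > 0 such that the initial value problem dσ(t)/dt = H(σ(t)), σ(0) = u₀, has a unique solution σ defined on [0, δ); moreover σ(t) ∈ M for all t ∈ [0, δ). -/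
open Metric Set Filter Topology

lemma fi_ekeland {E : Type*} [NormedAddCommGroup E] [CompleteSpace E]
    (S : Set E) (hS : IsClosed S) (x₀ : E) (hx₀ : x₀ ∈ S) (φ : E → ℝ) (hφ : ContinuousOn φ S)
    (hφ0 : ∀ x, 0 ≤ φ x) (c : ℝ) (hc : 0 < c) :
    ∃ x ∈ S, ∀ z ∈ S, φ z + c * dist z x ≤ φ x → z = x := by
  have step : ∀ x : S, ∃ z : S, φ z + c * dist (z : E) x ≤ φ x ∧
      ∀ w ∈ S, φ w + c * dist w (x : E) ≤ φ x → 2 * φ z ≤ φ x + φ w := by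
    intro x
    by_contra hcon
    push Not at hcon
    -- halving argument
    have key : ∀ n : ℕ, ∃ z : S, φ z + c * dist (z : E) x ≤ φ x := fun _ => ⟨x, by simp⟩
    let A : Set ℝ := φ '' {w | w ∈ S ∧ φ w + c * dist w (x : E) ≤ φ x}
    have hA : BddBelow A := ⟨0, by rintro _ ⟨w, _, rfl⟩; exact hφ0 w⟩
    have hxA : φ x ∈ A := ⟨x, ⟨x.2, by simp⟩, rfl⟩
    rcases (csInf_le hA hxA).lt_or_eq with h | h
    · obtain ⟨_, ⟨z, ⟨hz, hz1⟩, rfl⟩, hz2⟩ :=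
        exists_lt_of_csInf_lt ⟨_, hxA⟩ (show sInf A < (φ x + sInf A) / 2 by linarith)
      obtain ⟨w, hw, hw1, hw2⟩ := hcon ⟨z, hz⟩ hz1
      have := csInf_le hA (show φ w ∈ A from ⟨w, ⟨hw, hw1⟩, rfl⟩)
      simp only at hw2
      linarith
    · obtain ⟨w, hw, hw1, hw2⟩ := hcon x (by simp)
      have := csInf_le hA (show φ w ∈ A from ⟨w, ⟨hw, hw1⟩, rfl⟩)
      linarith
  choose T hT1 hT2 using step
  let x : ℕ → S := fun n => T^[n] ⟨x₀, hx₀⟩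
  have hx : ∀ n, x (n + 1) = T (x n) := fun n => Function.iterate_succ_apply' _ _ _
  have hmono : ∀ n m, φ (x (n + m)) + c * dist (x (n + m) : E) (x n) ≤ φ (x n) := by
    intro n m
    induction m with
    | zero => simp
    | succ m ih =>
      have h1 := hT1 (x (n + m))
      rw [← hx] at h1
      have h2 := dist_triangle (x (n + m + 1) : E) (x (n + m)) (x n)
      have := mul_le_mul_of_nonneg_left h2 hc.le
      rw [← add_assoc]
      linarith
  have hanti : Antitone (fun n => φ (x n)) := by
    intro n m hnm
    obtain ⟨k, rfl⟩ := Nat.exists_eq_add_of_le hnm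
    have := hmono n k
    have : 0 ≤ c * dist (x (n + k) : E) (x n) := by positivity
    simp only; linarith
  have hbdd : BddBelow (range (fun n => φ (x n))) := ⟨0, by rintro _ ⟨n, rfl⟩; exact hφ0 _⟩
  have hl := tendsto_atTop_ciInf hanti hbdd
  set l := ⨅ n, φ (x n)
  have hle : ∀ n, l ≤ φ (x n) := fun n => ciInf_le hbdd n
  have hd : ∀ N n, N ≤ n → dist (x n : E) (x N) ≤ (φ (x N) - l) / c := by
    intro N n hn
    obtain ⟨k, rfl⟩ := Nat.exists_eq_add_of_le hn
    rw [le_div_iff₀ hc]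
    have := hmono N k
    have := hle (N + k)
    linarith
  have hcau : CauchySeq (fun n => (x n : E)) := by
    refine cauchySeq_of_le_tendsto_0 (fun N => 2 * ((φ (x N) - l) / c)) ?_ ?_
    · intro n m N hn hm
      have := dist_triangle_right (x n : E) (x m) (x N)
      have := hd N n hn
      have := hd N m hm
      linarith
    · have : Tendsto (fun N => 2 * ((φ (x N) - l) / c)) atTop (𝓝 (2 * ((l - l) / c))) :=
        ((hl.sub_const l).div_const c).const_mul 2
      simpa using this
  obtain ⟨y, hy⟩ := cauchySeq_tendsto_of_complete hcau
  have hyS : y ∈ S := hS.mem_of_tendsto hy (Eventually.of_forall fun n => (x n).2)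
  have hφy : Tendsto (fun n => φ (x n)) atTop (𝓝 (φ y)) :=
    (hφ y hyS).tendsto.comp (tendsto_nhdsWithin_iff.2 ⟨hy, Eventually.of_forall fun n => (x n).2⟩)
  have hly : φ y = l := tendsto_nhds_unique hφy hl
  refine ⟨y, hyS, fun z hz hzy => ?_⟩
  have hyn : ∀ n, dist y (x n) ≤ (φ (x n) - l) / c := fun n =>
    le_of_tendsto (hy.dist tendsto_const_nhds) (eventually_atTop.2 ⟨n, fun m hm => hd n m hm⟩)
  have h2 : ∀ n, 2 * φ (x (n + 1)) ≤ φ (x n) + φ z := by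
    intro n
    rw [hx]
    apply hT2 _ _ hz
    have h3 := hyn n
    rw [le_div_iff₀ hc] at h3
    have := mul_le_mul_of_nonneg_left (dist_triangle z y (x n)) hc.le
    linarith
  have h3 : 2 * l ≤ l + φ z :=
    le_of_tendsto_of_tendsto' ((hl.comp (tendsto_add_atTop_nat 1)).const_mul 2)
      (hl.add_const (φ z)) h2
  have h4 : c * dist z y ≤ 0 := by linarith
  have : dist z y ≤ 0 := by
    by_contra h
    push Not at h
    have := mul_pos hc h
    linarith
  exact dist_le_zero.1 this

lemma fi_caristi {E : Type*} [NormedAddCommGroup E] [NormedSpace ℝ E] [CompleteSpace E]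
    (S : Set E) (hS : IsClosed S) (x₀ : E) (hx₀ : x₀ ∈ S) (f : E → E) (k : ℝ) (hk0 : 0 ≤ k)
    (hk : k < 1) (hf : ∀ x ∈ S, ∀ y ∈ S, ‖f x - f y‖ ≤ k * ‖x - y‖)
    (hin : ∀ x ∈ S, ∀ ε : ℝ, 0 < ε → ∃ h : ℝ, 0 < h ∧ h ≤ 1 ∧ ∃ z ∈ S,
      ‖x + h • (f x - x) - z‖ ≤ ε * h) : ∃ x ∈ S, f x = x := by
  have hfc : ContinuousOn f S := by
    refine LipschitzOnWith.continuousOn (K := ⟨k, hk0⟩) (LipschitzOnWith.of_dist_le_mul ?_)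
    intro x hx y hy
    rw [dist_eq_norm, dist_eq_norm]; exact hf x hx y hy
  obtain ⟨x, hx, hmin⟩ := fi_ekeland S hS x₀ hx₀ (fun x => ‖f x - x‖)
    (hfc.sub continuousOn_id).norm (fun _ => norm_nonneg _) ((1 - k) / 4) (by linarith)
  refine ⟨x, hx, ?_⟩
  by_contra hne
  have hpos : 0 < ‖f x - x‖ := norm_pos_iff.2 (sub_ne_zero.2 hne)
  obtain ⟨h, h0, h1, z, hz, hzx⟩ := hin x hx ((1 - k) / 4 * ‖f x - x‖) (by nlinarith)
  set p := ‖f x - x‖ with hp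
  set e := (1 - k) / 4 * p * h with he
  have a1 : ‖z - x‖ ≤ e + h * p := by
    calc ‖z - x‖ = ‖-(x + h • (f x - x) - z) + h • (f x - x)‖ := by congr 1; abel
      _ ≤ ‖-(x + h • (f x - x) - z)‖ + ‖h • (f x - x)‖ := norm_add_le _ _
      _ ≤ e + h * p := by
        rw [norm_neg, norm_smul, Real.norm_of_nonneg h0.le]; gcongr
  have a2 : ‖f z - z‖ ≤ k * ‖z - x‖ + (1 - h) * p + e := by
    calc ‖f z - z‖ = ‖(f z - f x) + (1 - h) • (f x - x) + (x + h • (f x - x) - z)‖ := by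
          congr 1; module
      _ ≤ ‖f z - f x‖ + ‖(1 - h) • (f x - x)‖ + ‖x + h • (f x - x) - z‖ := norm_add₃_le
      _ ≤ _ := by
        rw [norm_smul, Real.norm_of_nonneg (by linarith : 0 ≤ 1 - h)]
        have := hf z hz x hx
        gcongr
  have hph : 0 < p * h := mul_pos hpos h0
  have a3 : k * ‖z - x‖ ≤ k * (e + h * p) := mul_le_mul_of_nonneg_left a1 hk0
  have a4 : (1 - k) / 4 * ‖z - x‖ ≤ (1 - k) / 4 * (e + h * p) :=
    mul_le_mul_of_nonneg_left a1 (by linarith)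
  have a5 : ‖f z - z‖ + (1 - k) / 4 * ‖z - x‖ < p := by
    have : 0 < p * h * (1 - k) := mul_pos hph (by linarith)
    have h5 : 0 ≤ p * h * (1 - k) * k := mul_nonneg this.le hk0
    rw [he] at a2 a3 a4
    nlinarith
  have hzx' := hmin z hz (by rw [dist_eq_norm]; exact a5.le)
  subst hzx'
  simp [hp] at a5

lemma fi_resolvent {E : Type*} [NormedAddCommGroup E] [NormedSpace ℝ E] [CompleteSpace E]
    (M : Set E) (hMclosed : IsClosed M) (hMconv : Convex ℝ M) (H : E → E)
    (htang : ∀ u ∈ M,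
      Tendsto (fun β : ℝ => infDist (u + β • H u) M / β) (𝓝[>] 0) (𝓝 0))
    (u₀ : E) (r C k l : ℝ) (hk : 0 ≤ k)
    (hL : ∀ x ∈ M ∩ closedBall u₀ r, ∀ y ∈ M ∩ closedBall u₀ r, ‖H x - H y‖ ≤ k * ‖x - y‖)
    (hC : ∀ x ∈ M ∩ closedBall u₀ r, ‖H x‖ ≤ C)
    (hl0 : 0 < l) (hlk : l * k < 1) (y : E)
    (hy : y ∈ M) (hyr : ‖y - u₀‖ + l * C < r) (hC0 : 0 ≤ C) :
    ∃ x ∈ M ∩ closedBall u₀ r, x = y + l • H x := by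
  have hyS : y ∈ M ∩ closedBall u₀ r := by
    refine ⟨hy, ?_⟩
    rw [mem_closedBall, dist_eq_norm]
    have := mul_nonneg hl0.le hC0
    linarith
  suffices key : ∃ x ∈ M ∩ closedBall u₀ r, y + l • H x = x by
    obtain ⟨x, hx, hfx⟩ := key
    exact ⟨x, hx, hfx.symm⟩
  refine fi_caristi (M ∩ closedBall u₀ r) (hMclosed.inter isClosed_closedBall)
    y hyS (fun x => y + l • H x) (l * k) (by positivity) hlk ?_ ?_
  · intro a ha b hb
    rw [add_sub_add_left_eq_sub, ← smul_sub, norm_smul, Real.norm_of_nonneg hl0.le, mul_assoc]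
    exact mul_le_mul_of_nonneg_left (hL a ha b hb) hl0.le
  · intro x hx ε hε
    set ε' := min ε (r - (‖y - u₀‖ + l * C)) with hε'
    have hε'0 : 0 < ε' := lt_min hε (by linarith)
    have h1 : ∀ᶠ β : ℝ in 𝓝[>] 0, infDist (x + β • H x) M / β < ε' / l :=
      (htang x hx.1).eventually_lt_const (by positivity)
    have h2 : ∀ᶠ β : ℝ in 𝓝[>] 0, β < l := nhdsWithin_le_nhds (eventually_lt_nhds hl0)
    have h3 : ∀ᶠ β : ℝ in 𝓝[>] 0, 0 < β := eventually_mem_nhdsWithin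
    obtain ⟨β, ⟨hβ1, hβ2⟩, hβ0⟩ := ((h1.and h2).and h3).exists
    rw [div_lt_iff₀ hβ0, infDist_lt_iff ⟨y, hy⟩] at hβ1
    obtain ⟨w, hw, hwd⟩ := hβ1
    rw [dist_eq_norm] at hwd
    -- h = β / (2 l)
    set h := β / (2 * l) with hh
    have hβ : β = 2 * h * l := by rw [hh]; field_simp
    have hh0 : 0 < h := by positivity
    have hh1 : 2 * h ≤ 1 := by
      by_contra hcon
      push Not at hcon
      nlinarith
    have hq : x + (2 * h) • (y - x) ∈ M := by
      have := hMconv hx.1 hy (by linarith : 0 ≤ 1 - 2 * h) (by linarith : 0 ≤ 2 * h) (by ring)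
      convert this using 1; module
    have hz : (1 / 2 : ℝ) • (x + (2 * h) • (y - x)) + (1 / 2 : ℝ) • w ∈ M :=
      hMconv hq hw (by norm_num) (by norm_num) (by norm_num)
    set z := (1 / 2 : ℝ) • (x + (2 * h) • (y - x)) + (1 / 2 : ℝ) • w with hzdef
    have hzerr : ‖x + h • (y + l • H x - x) - z‖ ≤ ε' * h := by
      have : x + h • (y + l • H x - x) - z = (1 / 2 : ℝ) • (x + β • H x - w) := by
        rw [hzdef, hβ]; module
      rw [this, norm_smul, Real.norm_of_nonneg (by norm_num)]
      have h4 : ε' / l * β = 2 * (ε' * h) := by rw [hβ]; field_simp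
      rw [h4] at hwd
      linarith
    refine ⟨h, hh0, by linarith, z, ⟨hz, ?_⟩, hzerr.trans ?_⟩
    · rw [mem_closedBall, dist_eq_norm]
      have hxr : ‖x - u₀‖ ≤ r := by simpa [dist_eq_norm] using hx.2
      have hHx := hC x hx
      calc ‖z - u₀‖ = ‖(1 - h) • (x - u₀) + h • ((y - u₀) + l • H x)
              + -(x + h • (y + l • H x - x) - z)‖ := by congr 1; module
        _ ≤ ‖(1 - h) • (x - u₀)‖ + ‖h • ((y - u₀) + l • H x)‖
              + ‖-(x + h • (y + l • H x - x) - z)‖ := norm_add₃_le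
        _ ≤ (1 - h) * r + h * (‖y - u₀‖ + l * C) + ε' * h := by
          rw [norm_smul, norm_smul, norm_neg, Real.norm_of_nonneg hh0.le,
            Real.norm_of_nonneg (by linarith : 0 ≤ 1 - h)]
          have h5 : ‖(y - u₀) + l • H x‖ ≤ ‖y - u₀‖ + l * C := by
            refine (norm_add_le _ _).trans ?_
            rw [norm_smul, Real.norm_of_nonneg hl0.le]
            gcongr
          have h6 : 0 ≤ 1 - h := by linarith
          gcongr
        _ ≤ r := by
          have : ε' * h ≤ (r - (‖y - u₀‖ + l * C)) * h :=
            mul_le_mul_of_nonneg_right (min_le_right _ _) hh0.le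
          linarith
    · exact mul_le_mul_of_nonneg_right (min_le_left _ _) hh0.le

noncomputable def fiPoly {E : Type*} [NormedAddCommGroup E] [NormedSpace ℝ E]
    (x : ℕ → E) (l : ℝ) (t : ℝ) : E :=
  x ⌊t / l⌋₊ + (t / l - ⌊t / l⌋₊) • (x (⌊t / l⌋₊ + 1) - x ⌊t / l⌋₊)

lemma fiPoly_cont {E : Type*} [NormedAddCommGroup E] [NormedSpace ℝ E]
    (x : ℕ → E) (l : ℝ) (hl : 0 < l) (n : ℕ) :
    ContinuousOn (fiPoly x l) (Icc 0 (n * l)) := by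
  induction n with
  | zero => simp
  | succ n ih =>
    have h1 : Icc (0 : ℝ) ((n + 1 : ℕ) * l) ⊆ Icc 0 (n * l) ∪ Icc (n * l) ((n + 1 : ℕ) * l) :=
      Icc_subset_Icc_union_Icc
    refine ContinuousOn.mono (ContinuousOn.union_of_isClosed ih ?_ isClosed_Icc isClosed_Icc) h1
    have h2 : ContinuousOn (fun t : ℝ => x n + (t / l - n) • (x (n + 1) - x n))
        (Icc (n * l) ((n + 1 : ℕ) * l)) := by fun_prop
    refine h2.congr ?_
    intro t ht
    have ht1 : (n : ℝ) ≤ t / l := by rw [le_div_iff₀ hl]; exact ht.1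
    rcases ht.2.lt_or_eq with h | h
    · have : ⌊t / l⌋₊ = n := by
        rw [Nat.floor_eq_iff ((Nat.cast_nonneg n).trans ht1)]
        refine ⟨ht1, ?_⟩
        rw [div_lt_iff₀ hl]; exact_mod_cast h
      simp [fiPoly, this]
    · have h3 : t / l = (n + 1 : ℕ) := by rw [h]; field_simp
      simp only [fiPoly, h3, Nat.floor_natCast]
      push_cast
      module

lemma fiPoly_deriv {E : Type*} [NormedAddCommGroup E] [NormedSpace ℝ E]
    (x : ℕ → E) (l : ℝ) (hl : 0 < l) (t : ℝ) (ht : 0 ≤ t) :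
    HasDerivWithinAt (fiPoly x l) ((1 / l) • (x (⌊t / l⌋₊ + 1) - x ⌊t / l⌋₊)) (Ici t) t := by
  set n := ⌊t / l⌋₊ with hn
  have h2 : HasDerivWithinAt (fun t : ℝ => x n + (t / l - n) • (x (n + 1) - x n))
      ((1 / l) • (x (n + 1) - x n)) (Ici t) t := by
    apply HasDerivAt.hasDerivWithinAt
    have : HasDerivAt (fun t : ℝ => t / l - n) (1 / l) t :=
      ((hasDerivAt_id t).div_const l).sub_const _
    exact (this.smul_const (x (n + 1) - x n)).const_add (x n)
  refine h2.congr_of_eventuallyEq ?_ (by simp [fiPoly, ← hn])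
  have h3 : t < (n + 1) * l := by
    rw [← div_lt_iff₀ hl]; exact Nat.lt_floor_add_one _
  have h4 : ∀ᶠ s in 𝓝[≥] t, s < (n + 1) * l := nhdsWithin_le_nhds (eventually_lt_nhds h3)
  filter_upwards [h4, self_mem_nhdsWithin] with s hs hs2
  have hs3 : t / l ≤ s / l := div_le_div_of_nonneg_right hs2 hl.le
  have : ⌊s / l⌋₊ = n := by
    have h0 : 0 ≤ t / l := by positivity
    rw [Nat.floor_eq_iff (h0.trans hs3)]
    exact ⟨(Nat.floor_le h0).trans hs3, by rwa [div_lt_iff₀ hl]⟩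
  simp [fiPoly, this]

lemma fi_approx {E : Type*} [NormedAddCommGroup E] [NormedSpace ℝ E]
    (S : Set E) (hSconv : Convex ℝ S) (H : E → E) (u₀ : E) (hu₀ : u₀ ∈ S) (r C k δ : ℝ)
    (hk : 0 ≤ k) (hC0 : 0 ≤ C)
    (hL : ∀ x ∈ S, ∀ y ∈ S, ‖H x - H y‖ ≤ k * ‖x - y‖)
    (hC : ∀ x ∈ S, ‖H x‖ ≤ C) (hδ : 0 < δ) (hδC : 2 * δ * C < r)
    (hJ : ∀ l, 0 < l → l ≤ δ → ∀ y ∈ S, ‖y - u₀‖ + l * C < r → ∃ x ∈ S, x = y + l • H x)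
    (N : ℕ) :
    ∃ σ σ' : ℝ → E, ContinuousOn σ (Icc 0 δ) ∧ σ 0 = u₀ ∧ (∀ t ∈ Icc 0 δ, σ t ∈ S) ∧
      (∀ t ∈ Ico 0 δ, HasDerivWithinAt σ (σ' t) (Ici t) t) ∧
      (∀ t ∈ Ico 0 δ, dist (σ' t) (H (σ t)) ≤ k * C * δ * (1 / ((N : ℝ) + 1))) := by
  set l := δ / ((N : ℝ) + 1) with hl
  have hN : (0 : ℝ) < (N : ℝ) + 1 := by positivity
  have hl0 : 0 < l := by positivity
  have hNl : ((N : ℝ) + 1) * l = δ := by rw [hl]; field_simp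
  have hlδ : l ≤ δ := by
    rw [← hNl]; nlinarith [mul_nonneg (Nat.cast_nonneg (α := ℝ) N) hl0.le]
  have hstep : ∀ y : E, ∃ x : E, (y ∈ S ∧ ‖y - u₀‖ + l * C < r) → (x ∈ S ∧ x = y + l • H x) := by
    intro y
    by_cases h : y ∈ S ∧ ‖y - u₀‖ + l * C < r
    · obtain ⟨x, hx⟩ := hJ l hl0 hlδ y h.1 h.2
      exact ⟨x, fun _ => hx⟩
    · exact ⟨y, fun h' => absurd h' h⟩
  choose J hJ' using hstep
  let x : ℕ → E := fun n => J^[n] u₀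
  have hxs : ∀ n, x (n + 1) = J (x n) := fun n => Function.iterate_succ_apply' _ _ _
  have hcond : ∀ n : ℕ, n ≤ N + 1 → ‖x n - u₀‖ ≤ n * l * C → ‖x n - u₀‖ + l * C < r := by
    intro n hn h
    have : (n : ℝ) ≤ N + 1 := by exact_mod_cast hn
    have h1 : (n : ℝ) * l ≤ δ := by rw [← hNl]; gcongr
    have h2 : (n : ℝ) * l * C ≤ δ * C := by gcongr
    have h3 : l * C ≤ δ * C := by gcongr
    linarith
  have hx : ∀ n : ℕ, n ≤ N + 2 → x n ∈ S ∧ ‖x n - u₀‖ ≤ n * l * C := by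
    intro n
    induction n with
    | zero => intro _; simp [x, hu₀]
    | succ n ih =>
      intro hn
      obtain ⟨h1, h2⟩ := ih (by omega)
      obtain ⟨h3, h4⟩ := hJ' (x n) ⟨h1, hcond n (by omega) h2⟩
      rw [← hxs] at h3 h4
      refine ⟨h3, ?_⟩
      have h5 : ‖x (n + 1) - u₀‖ ≤ ‖x n - u₀‖ + l * C := by
        calc ‖x (n + 1) - u₀‖ = ‖(x n - u₀) + l • H (x (n + 1))‖ := by
              conv_lhs => rw [h4]
              congr 1; abel
          _ ≤ _ := by
            refine (norm_add_le _ _).trans ?_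
            rw [norm_smul, Real.norm_of_nonneg hl0.le]
            have := hC _ h3
            gcongr
      push_cast
      linarith
  have hxJ : ∀ n : ℕ, n ≤ N + 1 → x (n + 1) - x n = l • H (x (n + 1)) := by
    intro n hn
    obtain ⟨h1, h2⟩ := hx n (by omega)
    obtain ⟨h3, h4⟩ := hJ' (x n) ⟨h1, hcond n hn h2⟩
    rw [← hxs] at h4
    exact sub_eq_of_eq_add' h4
  have hfl : ∀ t ∈ Icc 0 δ, ⌊t / l⌋₊ ≤ N + 1 := by
    intro t ht
    apply Nat.floor_le_of_le
    rw [div_le_iff₀ hl0]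
    push_cast
    rw [hNl]; exact ht.2
  have hfr : ∀ t ∈ Icc 0 δ, 0 ≤ t / l - ⌊t / l⌋₊ ∧ t / l - ⌊t / l⌋₊ ≤ 1 := by
    intro t ht
    have := Nat.floor_le (div_nonneg ht.1 hl0.le)
    have := Nat.lt_floor_add_one (t / l)
    constructor <;> linarith
  have hmem : ∀ t ∈ Icc 0 δ, fiPoly x l t ∈ S := by
    intro t ht
    have hf := hfl t ht
    obtain ⟨h1, h2⟩ := hfr t ht
    have := hSconv (hx ⌊t / l⌋₊ (by omega)).1 (hx (⌊t / l⌋₊ + 1) (by omega)).1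
      (sub_nonneg.2 h2) h1 (by ring)
    convert this using 1
    unfold fiPoly
    module
  refine ⟨fiPoly x l, fun t => (1 / l) • (x (⌊t / l⌋₊ + 1) - x ⌊t / l⌋₊), ?_, ?_, hmem, ?_, ?_⟩
  · have := fiPoly_cont x l hl0 (N + 1)
    push_cast at this
    rwa [hNl] at this
  · simp [fiPoly, x]
  · intro t ht
    exact fiPoly_deriv x l hl0 t ht.1
  · intro t ht
    have ht' := Ico_subset_Icc_self ht
    have hf := hfl t ht'
    obtain ⟨h1, h2⟩ := hfr t ht'
    have h3 := (hx (⌊t / l⌋₊ + 1) (by omega)).1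
    have h4 := hxJ _ hf
    simp only
    have h5 : x (⌊t / l⌋₊ + 1) - fiPoly x l t
        = (1 - (t / l - ⌊t / l⌋₊)) • (l • H (x (⌊t / l⌋₊ + 1))) := by
      rw [← h4]; unfold fiPoly; module
    have h6 : ‖x (⌊t / l⌋₊ + 1) - fiPoly x l t‖ ≤ l * C := by
      rw [h5, norm_smul, norm_smul, Real.norm_of_nonneg hl0.le,
        Real.norm_of_nonneg (sub_nonneg.2 h2)]
      have := hC _ h3
      calc _ ≤ 1 * (l * C) := by
            gcongr
            linarith
        _ = _ := one_mul _
    rw [h4, smul_smul, one_div_mul_cancel hl0.ne', one_smul, dist_eq_norm]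
    calc _ ≤ k * ‖x (⌊t / l⌋₊ + 1) - fiPoly x l t‖ := hL _ h3 _ (hmem t ht')
      _ ≤ k * (l * C) := by gcongr
      _ = _ := by rw [hl]; ring

lemma fi_limit {E : Type*} [NormedAddCommGroup E] [NormedSpace ℝ E] [CompleteSpace E]
    (S : Set E) (hS : IsClosed S) (H : E → E) (u₀ : E) (K : NNReal) (hK : 0 < K)
    (hL : LipschitzOnWith K H S) (δ : ℝ) (hδ : 0 < δ)
    (s s' : ℕ → ℝ → E) (e : ℕ → ℝ) (he : Tendsto e atTop (𝓝 0)) (he0 : ∀ n, 0 ≤ e n)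
    (hc : ∀ n, ContinuousOn (s n) (Icc 0 δ)) (h0 : ∀ n, s n 0 = u₀)
    (hmem : ∀ n, ∀ t ∈ Icc 0 δ, s n t ∈ S)
    (hd : ∀ n, ∀ t ∈ Ico 0 δ, HasDerivWithinAt (s n) (s' n t) (Ici t) t)
    (hb : ∀ n, ∀ t ∈ Ico 0 δ, dist (s' n t) (H (s n t)) ≤ e n) :
    ∃ σ : ℝ → E, σ 0 = u₀ ∧ (∀ t ∈ Icc 0 δ, σ t ∈ S) ∧
      ∀ t ∈ Icc 0 δ, HasDerivWithinAt σ (H (σ t)) (Icc 0 δ) t := by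
  have hK' : (0 : ℝ) < K := by exact_mod_cast hK
  set D : ℝ := Real.exp (K * δ) / K with hD
  have hD0 : 0 < D := by positivity
  have hnm : ∀ n m, ∀ t ∈ Icc 0 δ, dist (s n t) (s m t) ≤ D * (e n + e m) := by
    intro n m t ht
    have h1 := dist_le_of_approx_trajectories_ODE_of_mem (v := fun _ => H) (s := fun _ => S)
      (K := K) (δ := 0) (fun _ _ => hL) (hc n) (hd n) (hb n)
      (fun t ht => hmem n t (Ico_subset_Icc_self ht)) (hc m) (hd m) (hb m)
      (fun t ht => hmem m t (Ico_subset_Icc_self ht)) (by simp [h0]) t ht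
    rw [gronwallBound_of_K_ne_0 hK'.ne'] at h1
    refine h1.trans ?_
    have h2 : Real.exp (K * (t - 0)) ≤ Real.exp (K * δ) := by
      apply Real.exp_le_exp.2
      have := ht.2
      gcongr
      linarith
    have h3 : 0 ≤ (e n + e m) / K := div_nonneg (add_nonneg (he0 n) (he0 m)) hK'.le
    calc _ ≤ (e n + e m) / K * Real.exp (K * δ) := by
          simp only [zero_mul, zero_add]
          apply mul_le_mul_of_nonneg_left _ h3
          linarith
      _ = _ := by rw [hD]; ring
  have hlim : ∀ t : ℝ, ∃ y, t ∈ Icc 0 δ → Tendsto (fun n => s n t) atTop (𝓝 y) := by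
    intro t
    by_cases ht : t ∈ Icc 0 δ
    · have hcau : CauchySeq (fun n => s n t) := by
        rw [Metric.cauchySeq_iff']
        intro ε hε
        have h1 : ∀ᶠ n in atTop, e n < ε / (2 * D) := he.eventually_lt_const (by positivity)
        obtain ⟨N, hN⟩ := eventually_atTop.1 h1
        refine ⟨N, fun n hn => (hnm n N t ht).trans_lt ?_⟩
        have h2 := hN n hn
        have h3 := hN N le_rfl
        calc D * (e n + e N) < D * (ε / (2 * D) + ε / (2 * D)) := by gcongr
          _ = ε := by field_simp; ring
      obtain ⟨y, hy⟩ := cauchySeq_tendsto_of_complete hcau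
      exact ⟨y, fun _ => hy⟩
    · exact ⟨0, fun h => absurd h ht⟩
  choose σ hσ using hlim
  have hrate : ∀ n, ∀ t ∈ Icc 0 δ, dist (s n t) (σ t) ≤ D * e n := by
    intro n t ht
    have h1 : Tendsto (fun m => D * (e n + e m)) atTop (𝓝 (D * (e n + 0))) :=
      (he.const_add (e n)).const_mul D
    rw [add_zero] at h1
    exact le_of_tendsto_of_tendsto' (tendsto_const_nhds.dist (hσ t ht)) h1
      (fun m => hnm n m t ht)
  have hDe : Tendsto (fun n => D * e n) atTop (𝓝 0) := by simpa using he.const_mul D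
  have hunif : TendstoUniformlyOn s σ atTop (Icc 0 δ) := by
    rw [Metric.tendstoUniformlyOn_iff]
    intro ε hε
    filter_upwards [hDe.eventually_lt_const hε] with n hn t ht
    rw [dist_comm]
    exact (hrate n t ht).trans_lt hn
  have hσc : ContinuousOn σ (Icc 0 δ) :=
    hunif.continuousOn (Eventually.of_forall hc).frequently
  have hσS : ∀ t ∈ Icc 0 δ, σ t ∈ S := fun t ht =>
    hS.mem_of_tendsto (hσ t ht) (Eventually.of_forall fun n => hmem n t ht)
  have hσ0 : σ 0 = u₀ := by
    refine tendsto_nhds_unique (hσ 0 ⟨le_rfl, hδ.le⟩) ?_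
    simp [h0]
  have hHσ : ContinuousOn (fun t => H (σ t)) (Icc 0 δ) := hL.continuousOn.comp hσc hσS
  let g : ℝ → E := IccExtend hδ.le ((Icc 0 δ).domRestrict fun t => H (σ t))
  have hg : Continuous g := hHσ.domRestrict.Icc_extend'
  have hgeq : ∀ t ∈ Icc 0 δ, g t = H (σ t) := fun t ht => by
    simp [g, IccExtend_of_mem hδ.le _ ht]
  let F : ℝ → E := fun t => u₀ + ∫ x in (0 : ℝ)..t, g x
  have hF : ∀ t, HasDerivAt F (g t) t := fun t =>
    ((hg.integral_hasStrictDerivAt 0 t).hasDerivAt).const_add u₀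
  have hFc : Continuous F := continuous_iff_continuousAt.2 fun t => (hF t).continuousAt
  have hσF : ∀ t ∈ Icc 0 δ, σ t = F t := by
    intro t ht
    have hest : ∀ n, ‖s n t - F t‖ ≤ (e n + K * (D * e n)) * (t - 0) := by
      intro n
      have h1 := norm_image_sub_le_of_norm_deriv_right_le_segment
        (f := fun t => s n t - F t) (f' := fun t => s' n t - g t) (C := e n + K * (D * e n))
        ((hc n).sub hFc.continuousOn)
        (fun x hx => (hd n x hx).sub (hF x).hasDerivWithinAt) ?_ t ht
      · simpa [F, h0] using h1
      · intro x hx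
        have hx' := Ico_subset_Icc_self hx
        rw [hgeq x hx', ← dist_eq_norm]
        have h2 := hL.dist_le_mul _ (hmem n x hx') _ (hσS x hx')
        have h3 := mul_le_mul_of_nonneg_left (hrate n x hx') hK'.le
        have h4 := dist_triangle (s' n x) (H (s n x)) (H (σ x))
        have h5 := hb n x hx
        linarith
    have h1 : Tendsto (fun n => (e n + K * (D * e n)) * (t - 0)) atTop
        (𝓝 ((0 + K * 0) * (t - 0))) := (he.add (hDe.const_mul _)).mul_const _
    have h2 : ‖σ t - F t‖ ≤ (0 + K * 0) * (t - 0) :=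
      le_of_tendsto_of_tendsto' ((hσ t ht).sub_const _).norm h1 hest
    simp only [mul_zero, add_zero, zero_mul, norm_le_zero_iff] at h2
    exact sub_eq_zero.1 h2
  refine ⟨σ, hσ0, hσS, fun t ht => ?_⟩
  rw [← hgeq t ht]
  exact (hF t).hasDerivWithinAt.congr hσF (hσF t ht)

lemma fi_unique {E : Type*} [NormedAddCommGroup E] [NormedSpace ℝ E]
    (M : Set E) (H : E → E) (hHlip : LocallyLipschitzOn M H) (δ : ℝ) (σ τ : ℝ → E)
    (h0 : τ 0 = σ 0)
    (hσ : ∀ t ∈ Ico (0 : ℝ) δ, σ t ∈ M ∧ HasDerivWithinAt σ (H (σ t)) (Ico (0 : ℝ) δ) t)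
    (hτ : ∀ t ∈ Ico (0 : ℝ) δ, τ t ∈ M ∧ HasDerivWithinAt τ (H (τ t)) (Ico (0 : ℝ) δ) t) :
    EqOn τ σ (Ico (0 : ℝ) δ) := by
  have hσc : ContinuousOn σ (Ico 0 δ) := fun t ht => (hσ t ht).2.continuousWithinAt
  have hτc : ContinuousOn τ (Ico 0 δ) := fun t ht => (hτ t ht).2.continuousWithinAt
  intro b hb
  have hsub : Icc 0 b ⊆ Ico 0 δ := fun t ht => ⟨ht.1, ht.2.trans_lt hb.2⟩
  have hclosed : IsClosed ({t | τ t = σ t} ∩ Icc 0 b) := by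
    have h1 : ContinuousOn (fun t => τ t - σ t) (Icc 0 b) := (hτc.sub hσc).mono hsub
    have h2 := h1.preimage_isClosed_of_isClosed isClosed_Icc (isClosed_singleton (x := (0 : E)))
    convert h2 using 1
    ext t
    simp [sub_eq_zero, and_comm]
  refine hclosed.Icc_subset_of_forall_exists_gt h0 ?_ (right_mem_Icc.2 hb.1)
  rintro t ⟨hteq, ht⟩ y hy
  have hteq' : τ t = σ t := hteq
  have htI : t ∈ Ico 0 δ := hsub (Ico_subset_Icc_self ht)
  obtain ⟨K, V, hV, hVL⟩ := hHlip (hσ t htI).1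
  have hnb : ∀ f : ℝ → E, ContinuousOn f (Ico 0 δ) → (∀ t ∈ Ico (0 : ℝ) δ, f t ∈ M) → f t = σ t →
      ∀ᶠ x in 𝓝[≥] t, f x ∈ V := by
    intro f hf hfM hft
    have h1 : Tendsto f (𝓝[Ico 0 δ] t) (𝓝[M] (f t)) :=
      tendsto_nhdsWithin_iff.2 ⟨hf t htI, eventually_mem_nhdsWithin.mono hfM⟩
    rw [hft] at h1
    have h2 : 𝓝[≥] t ≤ 𝓝[Ico 0 δ] t := by
      rw [nhdsWithin_le_iff]
      exact mem_of_superset (Ico_mem_nhdsGE htI.2) (Ico_subset_Ico_left htI.1)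
    exact h2 (h1 hV)
  have hev := (hnb σ hσc (fun t ht => (hσ t ht).1) rfl).and
    (hnb τ hτc (fun t ht => (hτ t ht).1) hteq')
  obtain ⟨c, hc, hcV⟩ := (mem_nhdsGE_iff_exists_Ico_subset).1 hev
  set d := min c (min y b) with hd
  have htd : t < d := lt_min hc (lt_min hy ht.2)
  have hdδ : d < δ := ((min_le_right _ _).trans (min_le_right _ _)).trans_lt hb.2
  have hsub2 : Icc t d ⊆ Ico 0 δ := fun x hx => ⟨htI.1.trans hx.1, hx.2.trans_lt hdδ⟩
  have hder : ∀ f : ℝ → E,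
      (∀ t ∈ Ico (0 : ℝ) δ, f t ∈ M ∧ HasDerivWithinAt f (H (f t)) (Ico (0 : ℝ) δ) t) →
      ∀ x ∈ Ico t d, HasDerivWithinAt f (H (f x)) (Ici x) x := by
    intro f hf x hx
    have hx' := hsub2 (Ico_subset_Icc_self hx)
    refine (hf x hx').2.mono_of_mem_nhdsWithin ?_
    exact mem_of_superset (Ico_mem_nhdsGE hx'.2) (Ico_subset_Ico_left hx'.1)
  have huniq := ODE_solution_unique_of_mem_Icc_right (v := fun _ => H) (s := fun _ => V) (K := K)
    (f := τ) (g := σ) (a := t) (b := d) (fun _ _ => hVL) (hτc.mono hsub2) (hder τ hτ)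
    (fun x hx => (hcV ⟨hx.1, hx.2.trans_le (min_le_left _ _)⟩).2) (hσc.mono hsub2) (hder σ hσ)
    (fun x hx => (hcV ⟨hx.1, hx.2.trans_le (min_le_left _ _)⟩).1) hteq'
  exact ⟨d, huniq (right_mem_Icc.2 htd.le), htd, (min_le_right _ _).trans (min_le_left _ _)⟩

/-- Local existence, uniqueness and invariance for an ODE on a closed convex
subset of a Banach space (Lemma 1.46 of Zou's book, quoted as Lemma 5.1). -/
theorem flow_invariance_closed_convex
    {E : Type*} [NormedAddCommGroup E] [NormedSpace ℝ E] [CompleteSpace E]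
    (M : Set E) (hMclosed : IsClosed M) (hMconv : Convex ℝ M)
    (H : E → E) (hHlip : LocallyLipschitzOn M H)
    (htang : ∀ u ∈ M,
      Tendsto (fun β : ℝ => infDist (u + β • H u) M / β) (𝓝[>] 0) (𝓝 0)) :
    ∀ u₀ ∈ M, ∃ δ : ℝ, 0 < δ ∧ ∃ σ : ℝ → E,
      -- σ is a solution of the IVP on [0, δ) with values in M
      (σ 0 = u₀ ∧ ∀ t ∈ Ico (0 : ℝ) δ,
        σ t ∈ M ∧ HasDerivWithinAt σ (H (σ t)) (Ico (0 : ℝ) δ) t) ∧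
      -- and it is the unique such solution
      (∀ τ : ℝ → E, (τ 0 = u₀ ∧ ∀ t ∈ Ico (0 : ℝ) δ,
          τ t ∈ M ∧ HasDerivWithinAt τ (H (τ t)) (Ico (0 : ℝ) δ) t) →
        EqOn τ σ (Ico (0 : ℝ) δ)) := by
  intro u₀ hu₀
  obtain ⟨K₀, V, hV, hVL⟩ := hHlip hu₀
  obtain ⟨r, hr, hrV⟩ := (nhdsWithin_hasBasis Metric.nhds_basis_closedBall M).mem_iff.1 hV
  set S := M ∩ closedBall u₀ r with hS
  have hSV : S ⊆ V := fun x hx => hrV ⟨hx.2, hx.1⟩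
  have hSL : LipschitzOnWith (K₀ + 1) H S := (hVL.mono hSV).weaken (by simp)
  set k : ℝ := ((K₀ + 1 : NNReal) : ℝ) with hk
  have hk0 : 0 < k := by rw [hk]; positivity
  have hL : ∀ x ∈ S, ∀ y ∈ S, ‖H x - H y‖ ≤ k * ‖x - y‖ := fun x hx y hy => by
    simpa only [dist_eq_norm] using hSL.dist_le_mul x hx y hy
  have hSc : IsClosed S := hMclosed.inter isClosed_closedBall
  have hSconv : Convex ℝ S := hMconv.inter (convex_closedBall _ _)
  have hu₀S : u₀ ∈ S := ⟨hu₀, mem_closedBall_self hr.le⟩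
  set C : ℝ := ‖H u₀‖ + k * r + 1 with hC
  have hC0 : 0 < C := by positivity
  have hHC : ∀ x ∈ S, ‖H x‖ ≤ C := by
    intro x hx
    have h1 := hL x hx u₀ hu₀S
    have h2 : ‖x - u₀‖ ≤ r := by simpa [dist_eq_norm] using hx.2
    have h3 := mul_le_mul_of_nonneg_left h2 hk0.le
    have h4 := norm_le_norm_add_norm_sub' (H x) (H u₀)
    linarith
  set δ : ℝ := min (r / (4 * C)) (1 / (2 * k)) with hδ
  have hδ0 : 0 < δ := by positivity
  have hδC : 2 * δ * C < r := by
    have : δ ≤ r / (4 * C) := min_le_left _ _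
    rw [le_div_iff₀ (by positivity)] at this
    linarith
  have hδk : δ * k < 1 := by
    have : δ ≤ 1 / (2 * k) := min_le_right _ _
    rw [le_div_iff₀ (by positivity)] at this
    linarith
  have hJ : ∀ l, 0 < l → l ≤ δ → ∀ y ∈ S, ‖y - u₀‖ + l * C < r → ∃ x ∈ S, x = y + l • H x := by
    intro l hl hlδ y hy hyr
    refine fi_resolvent M hMclosed hMconv H htang u₀ r C k l hk0.le hL hHC hl ?_ y hy.1 hyr hC0.le
    exact (mul_le_mul_of_nonneg_right hlδ hk0.le).trans_lt hδk
  choose s s' h1 h2 h3 h4 h5 using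
    fi_approx S hSconv H u₀ hu₀S r C k δ hk0.le hC0.le hL hHC hδ0 hδC hJ
  obtain ⟨σ, hσ0, hσS, hσd⟩ := fi_limit S hSc H u₀ (K₀ + 1) (by positivity) hSL δ hδ0 s s'
    (fun N => k * C * δ * (1 / ((N : ℝ) + 1)))
    (by simpa using (tendsto_one_div_add_atTop_nhds_zero_nat (𝕜 := ℝ)).const_mul (k * C * δ))
    (fun n => by positivity) h1 h2 h3 h4 h5
  have hσ : ∀ t ∈ Ico (0 : ℝ) δ, σ t ∈ M ∧ HasDerivWithinAt σ (H (σ t)) (Ico (0 : ℝ) δ) t :=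
    fun t ht => ⟨(hσS t (Ico_subset_Icc_self ht)).1,
      (hσd t (Ico_subset_Icc_self ht)).mono Ico_subset_Icc_self⟩
  refine ⟨δ, hδ0, σ, ⟨hσ0, hσ⟩, ?_⟩
  rintro τ ⟨hτ0, hτ⟩
  exact fi_unique M H hHlip δ σ τ (hτ0.trans hσ0.symm) hσ hτ
end
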